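/- Let m, σ > 0, k a positive integer, α > 1, and Δ₂ > 0. For q ∈ ℝ^k, let f_q^{(k)}(y) = ∏_{i=1}^k f(y_i - q_i) be the k-dimensional i.i.d. OSGT density at location q. Then for every pair q, q' ∈ ℝ^k with ‖q - q'‖₂ ≤ Δ₂, the Rényi divergence of order α satisfies (1/(α-1))·log ∫_{ℝ^k} f_q^{(k)}(y)^α · f_{q'}^{(k)}(y)^{1-α} dy ≤ α·Δ₂²/(2σ²) + (k/(α-1))·log((1 - Q(m/σ))/Q(m/σ)); i.e., the k-dimensional OSGT mechanism satisfies (ζ, ρ)-zero-concentrated differential privacy with ρ = Δ₂²/(2σ²) and ζ = (k/(α-1))·log((1 - Q(m/σ))/Q(m/σ)). -/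

import Mathlib

open MeasureTheory Real Filter Set

/-- The Gaussian Q-function: `Q x = (1/√(2π)) ∫_x^∞ exp (-t²/2) dt`. -/
noncomputable def gaussQ (x : ℝ) : ℝ :=
  (1 / Real.sqrt (2 * Real.pi)) * ∫ t in Set.Ioi x, Real.exp (-t ^ 2 / 2)

/-- The standard normal CDF: `Φ x = (1/√(2π)) ∫_{-∞}^x exp (-t²/2) dt`. -/
noncomputable def stdPhi (x : ℝ) : ℝ :=
  (1 / Real.sqrt (2 * Real.pi)) * ∫ t in Set.Iic x, Real.exp (-t ^ 2 / 2)

/-- The offset-symmetric Gaussian tails (OSGT) density with parameters `m`, `σ`,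
with normalization constant `S = 2√(2πσ²) Q(m/σ)`. -/
noncomputable def osgt (m σ y : ℝ) : ℝ :=
  if y ≤ 0 then
    Real.exp (-(y - m) ^ 2 / (2 * σ ^ 2)) /
      (2 * Real.sqrt (2 * Real.pi * σ ^ 2) * gaussQ (m / σ))
  else
    Real.exp (-(y + m) ^ 2 / (2 * σ ^ 2)) /
      (2 * Real.sqrt (2 * Real.pi * σ ^ 2) * gaussQ (m / σ))

theorem gaussQ_pos (x : ℝ) : 0 < gaussQ x := by
  unfold gaussQ
  refine mul_pos (by positivity) ?_
  have hint : Integrable (fun t : ℝ => Real.exp (-t ^ 2 / 2)) := by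
    refine (integrable_exp_neg_mul_sq (b := 1 / 2) (by norm_num)).congr (ae_of_all _ fun t => ?_)
    ring_nf
  rw [setIntegral_pos_iff_support_of_nonneg_ae (ae_of_all _ fun t => (Real.exp_pos _).le)
    hint.integrableOn]
  have hsupp : Function.support (fun t : ℝ => Real.exp (-t ^ 2 / 2)) = Set.univ := by
    ext t
    simp [Real.exp_ne_zero]
  simp [hsupp]

theorem gaussQ_le_half {x : ℝ} (hx : 0 ≤ x) : gaussQ x ≤ 1 / 2 := by
  have hint : Integrable (fun t : ℝ => Real.exp (-t ^ 2 / 2)) := by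
    refine (integrable_exp_neg_mul_sq (b := 1 / 2) (by norm_num)).congr (ae_of_all _ fun t => ?_)
    ring_nf
  have hle : ∫ t in Set.Ioi x, Real.exp (-t ^ 2 / 2) ≤ ∫ t in Set.Ioi 0, Real.exp (-t ^ 2 / 2) :=
    setIntegral_mono_set hint.integrableOn (ae_of_all _ fun t => (Real.exp_pos _).le)
      (Set.Ioi_subset_Ioi hx).eventuallyLE
  have hzero : ∫ t in Set.Ioi (0 : ℝ), Real.exp (-t ^ 2 / 2) = Real.sqrt (2 * Real.pi) / 2 := by
    have h := integral_gaussian_Ioi (1 / 2)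
    rw [show Real.pi / (1 / 2) = 2 * Real.pi by ring] at h
    rw [← h]
    congr 1 with t
    ring_nf
  have hs : 0 < Real.sqrt (2 * Real.pi) := by positivity
  unfold gaussQ
  calc (1 / Real.sqrt (2 * Real.pi)) * ∫ t in Set.Ioi x, Real.exp (-t ^ 2 / 2)
      ≤ (1 / Real.sqrt (2 * Real.pi)) * (Real.sqrt (2 * Real.pi) / 2) := by
        rw [← hzero]
        gcongr
    _ = 1 / 2 := by field_simp

/-- The normalization constant of the OSGT density. -/
noncomputable def osgtNorm (m σ : ℝ) : ℝ :=
  2 * Real.sqrt (2 * Real.pi * σ ^ 2) * gaussQ (m / σ)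

theorem osgtNorm_pos (m : ℝ) {σ : ℝ} (hσ : 0 < σ) : 0 < osgtNorm m σ := by
  have := gaussQ_pos (m / σ)
  unfold osgtNorm
  positivity

theorem osgt_eq_exp (m : ℝ) {σ : ℝ} (hσ : 0 < σ) (y : ℝ) :
    osgt m σ y = Real.exp (-(|y| + m) ^ 2 / (2 * σ ^ 2) - Real.log (osgtNorm m σ)) := by
  rw [Real.exp_sub, Real.exp_log (osgtNorm_pos m hσ)]
  unfold osgt osgtNorm
  split_ifs with hy
  · rw [abs_of_nonpos hy]
    ring_nf
  · rw [abs_of_pos (not_le.mp hy)]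

/-- The exponent of the Rényi integrand dominates a single shifted quadratic. -/
theorem exists_center_sq_le {m α : ℝ} (hm : 0 ≤ m) (hα : 1 ≤ α) (a b : ℝ) :
    ∃ c, ∀ y : ℝ, (y - c) ^ 2 - α * (α - 1) * (a - b) ^ 2 ≤
      α * (|y - a| + m) ^ 2 - (α - 1) * (|y - b| + m) ^ 2 := by
  have key : ∀ d u : ℝ, 0 ≤ d → (u - m + (α - 1) * d) ^ 2 - α * (α - 1) * d ^ 2 ≤
      α * (|u| + m) ^ 2 - (α - 1) * (|u - d| + m) ^ 2 := by
    intro d u hd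
    rcases le_total u 0 with hu | hu
    · rw [abs_of_nonpos hu, abs_of_nonpos (by linarith : u - d ≤ 0)]
      apply le_of_eq
      ring
    · rw [abs_of_nonneg hu]
      rcases le_total u d with hud | hud
      · rw [abs_of_nonpos (by linarith : u - d ≤ 0)]
        have : 0 ≤ 4 * α * m * u := by positivity
        linear_combination this
      · rw [abs_of_nonneg (by linarith : 0 ≤ u - d)]
        have h1 : 0 ≤ u + (α - 1) * d := add_nonneg hu (mul_nonneg (by linarith) hd)
        have : 0 ≤ 4 * m * (u + (α - 1) * d) := by positivity
        linear_combination this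
  rcases le_total a b with hab | hab
  · refine ⟨a + m - (α - 1) * (b - a), fun y => ?_⟩
    have h := key (b - a) (y - a) (by linarith)
    rw [show y - a - (b - a) = y - b by ring] at h
    linear_combination h
  · refine ⟨a - m + (α - 1) * (a - b), fun y => ?_⟩
    have h := key (a - b) (a - y) (by linarith)
    rw [show a - y - (a - b) = b - y by ring, abs_sub_comm a y, abs_sub_comm b y] at h
    linear_combination h

theorem exists_osgt_rpow_mul_rpow_le {m σ α : ℝ} (hm : 0 ≤ m) (hσ : 0 < σ) (hα : 1 ≤ α)
    (a b : ℝ) :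
    ∃ c, ∀ y : ℝ, osgt m σ (y - a) ^ α * osgt m σ (y - b) ^ (1 - α) ≤
      Real.exp (α * (α - 1) * (a - b) ^ 2 / (2 * σ ^ 2)) / osgtNorm m σ *
        Real.exp (-(1 / (2 * σ ^ 2)) * (y - c) ^ 2) := by
  obtain ⟨c, hc⟩ := exists_center_sq_le hm hα a b
  refine ⟨c, fun y => ?_⟩
  rw [osgt_eq_exp m hσ, osgt_eq_exp m hσ, ← Real.exp_mul, ← Real.exp_mul, ← Real.exp_add]
  nth_rewrite 3 [← Real.exp_log (osgtNorm_pos m hσ)]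
  rw [← Real.exp_sub, ← Real.exp_add, Real.exp_le_exp]
  have h := mul_le_mul_of_nonneg_left (hc y) (by positivity : 0 ≤ 1 / (2 * σ ^ 2))
  linear_combination h

theorem integrable_gaussian_shift {σ : ℝ} (hσ : 0 < σ) (A c : ℝ) :
    Integrable (fun y : ℝ => A * Real.exp (-(1 / (2 * σ ^ 2)) * (y - c) ^ 2)) :=
  ((integrable_exp_neg_mul_sq (b := 1 / (2 * σ ^ 2)) (by positivity)).comp_sub_right c).const_mul A

theorem integral_gaussian_shift (σ A c : ℝ) :
    ∫ y : ℝ, A * Real.exp (-(1 / (2 * σ ^ 2)) * (y - c) ^ 2) =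
      A * Real.sqrt (2 * Real.pi * σ ^ 2) := by
  rw [integral_const_mul,
    integral_sub_right_eq_self (fun y : ℝ => Real.exp (-(1 / (2 * σ ^ 2)) * y ^ 2)) c,
    integral_gaussian]
  congr 2
  rw [div_div_eq_mul_div, div_one]
  ring

theorem osgt_pos (m : ℝ) {σ : ℝ} (hσ : 0 < σ) (y : ℝ) : 0 < osgt m σ y := by
  rw [osgt_eq_exp m hσ]
  exact Real.exp_pos _

theorem integral_prod_osgt_le {ι : Type*} [Fintype ι] {m σ α : ℝ} (hm : 0 ≤ m) (hσ : 0 < σ)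
    (hα : 1 ≤ α) (q q' : ι → ℝ) :
    ∫ y : ι → ℝ, (∏ i, osgt m σ (y i - q i)) ^ α * (∏ i, osgt m σ (y i - q' i)) ^ (1 - α) ≤
      Real.exp (α * (α - 1) * (∑ i, (q i - q' i) ^ 2) / (2 * σ ^ 2)) *
        (1 / (2 * gaussQ (m / σ))) ^ Fintype.card ι := by
  choose c hc using fun i => exists_osgt_rpow_mul_rpow_le hm hσ hα (q i) (q' i)
  have hprod : ∀ y : ι → ℝ,
      (∏ i, osgt m σ (y i - q i)) ^ α * (∏ i, osgt m σ (y i - q' i)) ^ (1 - α) =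
        ∏ i, osgt m σ (y i - q i) ^ α * osgt m σ (y i - q' i) ^ (1 - α) := by
    intro y
    rw [Finset.prod_mul_distrib, Real.finsetProd_rpow _ _ fun i _ => (osgt_pos m hσ _).le,
      Real.finsetProd_rpow _ _ fun i _ => (osgt_pos m hσ _).le]
  have hnn : ∀ (y : ι → ℝ) (i : ι),
      0 ≤ osgt m σ (y i - q i) ^ α * osgt m σ (y i - q' i) ^ (1 - α) := fun y i =>
    mul_nonneg (Real.rpow_nonneg (osgt_pos m hσ _).le _) (Real.rpow_nonneg (osgt_pos m hσ _).le _)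
  calc ∫ y : ι → ℝ, (∏ i, osgt m σ (y i - q i)) ^ α * (∏ i, osgt m σ (y i - q' i)) ^ (1 - α)
      ≤ ∫ y : ι → ℝ, ∏ i, Real.exp (α * (α - 1) * (q i - q' i) ^ 2 / (2 * σ ^ 2)) /
          osgtNorm m σ * Real.exp (-(1 / (2 * σ ^ 2)) * (y i - c i) ^ 2) := by
        simp_rw [hprod]
        refine integral_mono_of_nonneg (ae_of_all _ fun y => Finset.prod_nonneg fun i _ => hnn y i)
          (Integrable.fintype_prod fun i => integrable_gaussian_shift hσ _ _)
          (ae_of_all _ fun y => Finset.prod_le_prod (fun i _ => hnn y i) fun i _ => hc i (y i))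
    _ = ∏ i, Real.exp (α * (α - 1) * (q i - q' i) ^ 2 / (2 * σ ^ 2)) *
          (1 / (2 * gaussQ (m / σ))) := by
        rw [integral_fintype_prod_volume_eq_prod (fun i (x : ℝ) =>
          Real.exp (α * (α - 1) * (q i - q' i) ^ 2 / (2 * σ ^ 2)) /
            osgtNorm m σ * Real.exp (-(1 / (2 * σ ^ 2)) * (x - c i) ^ 2))]
        refine Finset.prod_congr rfl fun i _ => ?_
        rw [integral_gaussian_shift, osgtNorm]
        have hQ := gaussQ_pos (m / σ)
        have hs : 0 < Real.sqrt (2 * Real.pi * σ ^ 2) := by positivity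
        field_simp
    _ = _ := by
        rw [Finset.prod_mul_distrib, ← Real.exp_sum, Finset.prod_const, Finset.card_univ,
          Finset.mul_sum, Finset.sum_div]

/-- the `k`-dimensional OSGT mechanism satisfies `(ζ, ρ)`-zCDP with
`ρ = Δ₂²/(2σ²)` and `ζ = (k/(α-1))·log((1-Q(m/σ))/Q(m/σ))`. -/
theorem osgt_zcdp (m σ : ℝ) (hm : 0 < m) (hσ : 0 < σ) (k : ℕ) (hk : 0 < k)
    (α : ℝ) (hα : 1 < α) (Δ₂ : ℝ) (hΔ₂ : 0 < Δ₂)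
    (q q' : Fin k → ℝ) (hqq : Real.sqrt (∑ i, (q i - q' i) ^ 2) ≤ Δ₂) :
    (1 / (α - 1)) * Real.log (∫ y : Fin k → ℝ,
        (∏ i, osgt m σ (y i - q i)) ^ α * (∏ i, osgt m σ (y i - q' i)) ^ (1 - α)) ≤
      α * Δ₂ ^ 2 / (2 * σ ^ 2) +
        ((k : ℝ) / (α - 1)) * Real.log ((1 - gaussQ (m / σ)) / gaussQ (m / σ)) := by
  have hQ := gaussQ_pos (m / σ)
  have hQ2 : gaussQ (m / σ) ≤ 1 / 2 := gaussQ_le_half (by positivity)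
  have hα' : 0 < α - 1 := by linarith
  have hsum : ∑ i, (q i - q' i) ^ 2 ≤ Δ₂ ^ 2 := (Real.sqrt_le_left hΔ₂.le).mp hqq
  have hratio : 1 / (2 * gaussQ (m / σ)) ≤ (1 - gaussQ (m / σ)) / gaussQ (m / σ) := by
    rw [div_le_div_iff₀ (by positivity) hQ]
    nlinarith
  have hone : 1 ≤ (1 - gaussQ (m / σ)) / gaussQ (m / σ) := by
    rw [le_div_iff₀ hQ]
    linarith
  set R := (1 - gaussQ (m / σ)) / gaussQ (m / σ)
  set I := ∫ y : Fin k → ℝ,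
    (∏ i, osgt m σ (y i - q i)) ^ α * (∏ i, osgt m σ (y i - q' i)) ^ (1 - α)
  have hbound : I ≤ Real.exp (α * (α - 1) * Δ₂ ^ 2 / (2 * σ ^ 2)) * R ^ k := by
    refine (integral_prod_osgt_le hm.le hσ hα.le q q').trans ?_
    rw [Fintype.card_fin]
    gcongr
  have hI0 : 0 ≤ I := integral_nonneg fun y => mul_nonneg
    (Real.rpow_nonneg (Finset.prod_nonneg fun i _ => (osgt_pos m hσ _).le) _)
    (Real.rpow_nonneg (Finset.prod_nonneg fun i _ => (osgt_pos m hσ _).le) _)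
  have hR0 : 0 < R := by linarith
  have hlog : Real.log I ≤ α * (α - 1) * Δ₂ ^ 2 / (2 * σ ^ 2) + k * Real.log R := by
    rcases hI0.eq_or_lt with h0 | h0
    · rw [← h0, Real.log_zero]
      have := Real.log_nonneg hone
      positivity
    · refine (Real.log_le_log h0 hbound).trans_eq ?_
      rw [Real.log_mul (Real.exp_ne_zero _) (by positivity), Real.log_exp, Real.log_pow]
  calc 1 / (α - 1) * Real.log I
      ≤ 1 / (α - 1) * (α * (α - 1) * Δ₂ ^ 2 / (2 * σ ^ 2) + k * Real.log R) := by gcongr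
    _ = _ := by field_simp
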